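/- Let F be a finite field with q elements, m₁,…,m_n positive integers with all m_j odd, b₁,…,b_n ∈ F nonzero, and a₁,…,a_n ∈ F nonzero. Set d_j⁻ = gcd(m_j, q-1) and d_j⁺ = gcd(m_j, q+1). Assume (1/2)∑_{j=1}^n 1/d_j⁻ + (1/2 + 1/(q-1))·∑_{j=1}^n 1/d_j⁺ > 1 + n/(q-1). Then the equation b₁D_{m₁}(X₁,a₁) + … + b_nD_{m_n}(X_n,a_n) = 0 has a nontrivial solution in Fⁿ. -/

import Mathlib

open MvPolynomial in
/-- A polynomial of small degree that does not vanish at the origin has a second nonzero value on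
every large enough grid through the origin. -/
theorem MvPolynomial.exists_ne_zero_eval_ne_zero_of_totalDegree_lt {R σ : Type*} [Field R]
    [Fintype σ] (G : MvPolynomial σ R) (hG : eval 0 G ≠ 0) (A : σ → Finset R)
    (h0 : ∀ i, 0 ∈ A i) (hdeg : G.totalDegree < ∑ i, ((A i).card - 1)) :
    ∃ v : σ → R, v ≠ 0 ∧ (∀ i, v i ∈ A i) ∧ eval v G ≠ 0 := by
  classical
  let _ : LinearOrder σ := WellOrderingRel.isWellOrder.linearOrder
  let M : MvPolynomial σ R := ∏ i, ∏ r ∈ (A i).erase 0, (X i - C r)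
  let t : σ →₀ ℕ := Finsupp.equivFunOnFinite.symm fun i ↦ (A i).card - 1
  have hinner (i : σ) : MonomialOrder.degLex.Monic
      (∏ r ∈ (A i).erase 0, (X i - C r) : MvPolynomial σ R) :=
    MonomialOrder.Monic.prod fun r _ ↦ MonomialOrder.monic_X_sub_C _ i r
  have hinnerdeg (i : σ) : MonomialOrder.degLex.degree
      (∏ r ∈ (A i).erase 0, (X i - C r) : MvPolynomial σ R) =
      Finsupp.single i ((A i).card - 1) := by
    rw [MonomialOrder.degree_prod_of_regular]
    · simp [Finset.sum_congr rfl (fun r _ ↦ MonomialOrder.degLex.degree_X_sub_C i r),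
        Finset.card_erase_of_mem (h0 i)]
    · intro r _
      rw [MonomialOrder.monic_X_sub_C]
      exact isRegular_one
  have hMt : coeff t M = 1 := by
    have h := MonomialOrder.degLex.coeff_prod_sum_degree
      (fun i ↦ (∏ r ∈ (A i).erase 0, (X i - C r) : MvPolynomial σ R)) Finset.univ
    have ht : t = ∑ i, Finsupp.single i ((A i).card - 1) := by
      rw [Finsupp.univ_sum_single t |>.symm]
      rfl
    simp only [hinnerdeg, ← ht, (hinner _).leadingCoeff_eq_one, Finset.prod_const_one] at h
    exact h
  have htdeg : t.degree = ∑ i, ((A i).card - 1) := by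
    simp [Finsupp.degree_eq_sum, t]
  have hMdeg : M.totalDegree ≤ t.degree := by
    rw [htdeg]
    refine (totalDegree_finsetProd _ _).trans (Finset.sum_le_sum fun i _ ↦ ?_)
    refine (totalDegree_finsetProd _ _).trans ?_
    rw [← Finset.card_erase_of_mem (h0 i), Finset.card_eq_sum_ones]
    refine Finset.sum_le_sum fun r _ ↦ ?_
    exact (totalDegree_sub_C_le _ _).trans (totalDegree_X _).le
  have hM0 : eval 0 M ≠ 0 := by
    simp only [M, eval_prod, map_sub, eval_X, eval_C, Pi.zero_apply, Finset.prod_ne_zero_iff]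
    intro i _ r hr
    simpa using (Finset.mem_erase.mp hr).1
  let c : R := eval 0 G / eval 0 M
  have hc : c ≠ 0 := div_ne_zero hG hM0
  have hcoeff : coeff t (G - C c * M) ≠ 0 := by
    have hGt : coeff t G = 0 := coeff_eq_zero_of_totalDegree_lt (by
      rw [← htdeg] at hdeg
      exact hdeg)
    simp [hGt, hMt, hc]
  have htot : (G - C c * M).totalDegree = t.degree := by
    refine le_antisymm ?_ ?_
    · refine (totalDegree_sub _ _).trans (max_le (htdeg ▸ hdeg.le) ?_)
      refine (totalDegree_mul _ _).trans ?_
      simpa using hMdeg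
    · exact le_totalDegree (mem_support_iff.mpr hcoeff)
  obtain ⟨v, hvA, hv⟩ := combinatorial_nullstellensatz_exists_eval_nonzero (G - C c * M) t hcoeff
    htot A fun i ↦ by
      have := Finset.card_pos.mpr ⟨0, h0 i⟩
      simp only [t, Finsupp.coe_equivFunOnFinite_symm]
      omega
  have hv0 : v ≠ 0 := by
    rintro rfl
    exact hv (by rw [map_sub, map_mul, eval_C, div_mul_cancel₀ _ hM0, sub_self])
  refine ⟨v, hv0, hvA, ?_⟩
  obtain ⟨i, hi⟩ := Function.ne_iff.mp hv0
  have hMv : eval v M = 0 := by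
    simp only [M, eval_prod, map_sub, eval_X, eval_C]
    exact Finset.prod_eq_zero (Finset.mem_univ i)
      (Finset.prod_eq_zero (Finset.mem_erase.mpr ⟨hi, hvA i⟩) (sub_self _))
  simpa [hMv] using hv

open MvPolynomial in
/-- A linear form has a nontrivial zero on every grid through the origin whose side lengths, each
diminished by one, add up to at least the size of the finite field. -/
theorem FiniteField.exists_ne_zero_sum_mul_eq_zero {F σ : Type*} [Field F] [Fintype F] [Fintype σ]
    (b : σ → F) (A : σ → Finset F) (h0 : ∀ i, 0 ∈ A i)
    (hcard : Fintype.card F - 1 < ∑ i, ((A i).card - 1)) :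
    ∃ v : σ → F, v ≠ 0 ∧ (∀ i, v i ∈ A i) ∧ ∑ i, b i * v i = 0 := by
  have hq : Fintype.card F - 1 ≠ 0 := by
    have := Fintype.one_lt_card (α := F)
    omega
  let L : MvPolynomial σ F := ∑ i, C (b i) * X i
  have hL : L.totalDegree ≤ 1 :=
    totalDegree_finsetSum_le fun i _ ↦ (totalDegree_mul _ _).trans (by simp)
  obtain ⟨v, hv0, hvA, hv⟩ := exists_ne_zero_eval_ne_zero_of_totalDegree_lt
    (1 - L ^ (Fintype.card F - 1)) (by simp [L, hq]) A h0 (by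
      refine lt_of_le_of_lt ((totalDegree_sub _ _).trans (max_le (by simp) ?_)) hcard
      exact (totalDegree_pow _ _).trans (by nlinarith))
  refine ⟨v, hv0, hvA, ?_⟩
  by_contra hne
  refine hv ?_
  have : eval v L = ∑ i, b i * v i := by simp [L]
  rw [map_sub, map_one, map_pow, this, FiniteField.pow_card_sub_one_eq_one _ hne, sub_self]

namespace Polynomial

theorem eval_dickson_one_add {R : Type*} [CommRing R] {a x y : R} (h : x * y = a) :
    ∀ n, (dickson 1 a n).eval (x + y) = x ^ n + y ^ n
  | 0 => by
    simp only [pow_zero, dickson_zero]; norm_num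
  | 1 => by simp
  | n + 2 => by
    simp only [dickson_add_two, eval_sub, eval_mul, eval_X, eval_C, eval_dickson_one_add h n,
      eval_dickson_one_add h (n + 1)]
    rw [← h]
    ring

theorem eval_zero_dickson_of_odd {R : Type*} [CommRing R] (k : ℕ) (a : R) {n : ℕ} (hn : Odd n) :
    (dickson k a n).eval 0 = 0 := by
  obtain ⟨r, rfl⟩ := hn
  induction r with
  | zero => simp
  | succ r ih =>
    rw [show 2 * (r + 1) + 1 = 2 * r + 1 + 2 by ring, dickson_add_two]
    simp [ih]

theorem card_toFinset_nthRoots {K : Type*} [Field K] [IsAlgClosed K] [DecidableEq K] {N : ℕ} {c : K}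
    (hN : (N : K) ≠ 0) (hc : c ≠ 0) : (nthRoots N c).toFinset.card = N := by
  have hsep := separable_X_pow_sub_C c hN hc
  rw [nthRoots, Multiset.toFinset_card_of_nodup (nodup_roots hsep),
    IsAlgClosed.card_roots_eq_natDegree, natDegree_X_pow_sub_C]

theorem card_toFinset_nthRoots_le_gcd_mul {K : Type*} [Field K] [DecidableEq K] (m : ℕ) {N : ℕ}
    (hN : 0 < N) {c : K} (hc : c ≠ 0) :
    (nthRoots N c).toFinset.card ≤
      Nat.gcd m N * ((nthRoots N c).toFinset.image (· ^ m)).card := by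
  refine Finset.card_le_mul_card_image _ _ fun z hz ↦ ?_
  obtain ⟨y, hy, rfl⟩ := Finset.mem_image.mp hz
  rw [Multiset.mem_toFinset, mem_nthRoots hN] at hy
  have hy0 : y ≠ 0 := by
    rintro rfl
    exact hc (by rw [← hy, zero_pow hN.ne'])
  calc _ ≤ (nthRoots (Nat.gcd m N) (1 : K)).toFinset.card := by
        refine Finset.card_le_card_of_injOn (· / y) (fun w hw ↦ ?_)
          fun w _ w' _ h ↦ (div_left_inj' hy0).mp h
        simp only [Finset.coe_filter, Set.mem_ofPred_eq, Multiset.mem_toFinset,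
          mem_nthRoots hN] at hw
        simp only [Finset.mem_coe, Multiset.mem_toFinset]
        rw [mem_nthRoots (Nat.gcd_pos_of_pos_right m hN)]
        refine pow_gcd_eq_one.mpr ⟨?_, ?_⟩
        · rw [div_pow, hw.2, div_self (pow_ne_zero _ hy0)]
        · rw [div_pow, hw.1, hy, div_self hc]
    _ ≤ _ := (Multiset.toFinset_card_le _).trans (card_nthRoots _ _)

end Polynomial

theorem FiniteField.exists_algebraMap_eq_of_pow_card_eq {F K : Type*} [Field F] [Fintype F]
    [Field K] [Algebra F K] {x : K} (hx : x ^ Fintype.card F = x) :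
    ∃ y : F, algebraMap F K y = x := by
  classical
  have hq := Fintype.one_lt_card (α := F)
  have hne := FiniteField.X_pow_card_sub_X_ne_zero K hq
  have hsub : Finset.univ.image (algebraMap F K) ⊆
      (Polynomial.X ^ Fintype.card F - Polynomial.X : Polynomial K).roots.toFinset := by
    intro z hz
    obtain ⟨y, -, rfl⟩ := Finset.mem_image.mp hz
    simp [hne, ← map_pow, FiniteField.pow_card]
  have heq := Finset.eq_of_subset_of_card_le hsub (by
    rw [Finset.card_image_of_injective _ (algebraMap F K).injective, Finset.card_univ]
    exact (Multiset.toFinset_card_le _).trans ((Polynomial.card_roots' _).trans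
      (FiniteField.X_pow_card_sub_X_natDegree_eq K hq).le))
  have hmem : x ∈ Finset.univ.image (algebraMap F K) := by
    rw [heq]
    simp [hne, hx]
  simpa using hmem

/-- The fibres of `z ↦ z + c / z` on two sets of nonzero elements overlapping only in square roots
of `c` have at most two elements in total. -/
theorem card_add_card_le_two_mul_of_maps_to_add_div {K : Type*} [Field K] [DecidableEq K]
    {c : K} {S T W : Finset K} (hS : ∀ z ∈ S, z ≠ 0) (hT : ∀ z ∈ T, z ≠ 0)
    (hST : ∀ z ∈ S, z ∈ T → z ^ 2 = c) (hSW : ∀ z ∈ S, z + c / z ∈ W)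
    (hTW : ∀ z ∈ T, z + c / z ∈ W) : S.card + T.card ≤ 2 * W.card := by
  rw [Finset.card_eq_sum_card_fiberwise hSW, Finset.card_eq_sum_card_fiberwise hTW,
    ← Finset.sum_add_distrib, mul_comm, ← smul_eq_mul]
  refine Finset.sum_le_card_nsmul _ _ _ fun v _ ↦ ?_
  set P := S.filter fun z ↦ z + c / z = v with hP
  set Q := T.filter fun z ↦ z + c / z = v with hQ
  have hmem {z : K} (hz : z ∈ P ∪ Q) : z ≠ 0 ∧ z + c / z = v := by
    rcases Finset.mem_union.mp hz with h | h
    · exact ⟨hS z (Finset.mem_filter.mp h).1, (Finset.mem_filter.mp h).2⟩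
    · exact ⟨hT z (Finset.mem_filter.mp h).1, (Finset.mem_filter.mp h).2⟩
  have hpair {z w : K} (hz : z ∈ P ∪ Q) (hw : w ∈ P ∪ Q) : w = z ∨ w = c / z := by
    obtain ⟨hz0, hzv⟩ := hmem hz
    obtain ⟨hw0, hwv⟩ := hmem hw
    have h := hwv.trans hzv.symm
    field_simp at h
    have : (w - z) * (w * z - c) = 0 := by linear_combination h
    rcases mul_eq_zero.mp this with h | h
    · exact Or.inl (sub_eq_zero.mp h)
    · exact Or.inr (by rw [eq_div_iff hz0]; exact sub_eq_zero.mp h)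
  rw [← Finset.card_union_add_card_inter]
  rcases (P ∩ Q).eq_empty_or_nonempty with hemp | ⟨z, hz⟩
  · rw [hemp, Finset.card_empty, add_zero]
    rcases (P ∪ Q).eq_empty_or_nonempty with hemp' | ⟨z, hz⟩
    · simp [hemp']
    · refine (Finset.card_le_card (t := {z, c / z}) fun w hw ↦ ?_).trans Finset.card_le_two
      simpa using hpair hz hw
  · have hzP := Finset.mem_of_mem_inter_left hz
    have hzQ := Finset.mem_of_mem_inter_right hz
    have hzu : z ∈ P ∪ Q := Finset.mem_union_left _ hzP
    have hsq := hST z (Finset.mem_filter.mp hzP).1 (Finset.mem_filter.mp hzQ).1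
    have hdiv : c / z = z := by
      rw [← hsq, sq, mul_div_cancel_right₀ _ (hmem hzu).1]
    have hunion : (P ∪ Q).card ≤ 1 := Finset.card_le_one_iff_subset_singleton.mpr
      ⟨z, fun w hw ↦ by simpa [hdiv] using hpair hzu hw⟩
    have hinter : (P ∩ Q).card ≤ (P ∪ Q).card :=
      Finset.card_le_card (Finset.inter_subset_left.trans Finset.subset_union_left)
    omega

open Polynomial in
/-- A lower bound for the size of the value set of a Dickson polynomial over a finite field. -/
theorem FiniteField.le_two_mul_card_image_eval_dickson {F : Type*} [Field F] [Fintype F]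
    [DecidableEq F] {a : F} (ha : a ≠ 0) {m : ℕ} (hm : 0 < m) :
    ((Fintype.card F : ℚ) - 1) / Nat.gcd m (Fintype.card F - 1) +
        ((Fintype.card F : ℚ) + 1) / Nat.gcd m (Fintype.card F + 1) ≤
      2 * (Finset.univ.image fun x ↦ (dickson 1 a m).eval x).card := by
  classical
  set q := Fintype.card F with hq
  have hq1 : 1 < q := Fintype.one_lt_card
  let K := AlgebraicClosure F
  let φ : F →+* K := algebraMap F K
  have hqK : (q : K) = 0 := by
    rw [← map_natCast φ, hq, FiniteField.cast_card_eq_zero, map_zero]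
  have hα : φ a ≠ 0 := by simpa using ha
  have hαq : φ a ^ q = φ a := by rw [← map_pow, FiniteField.pow_card]
  have hadd (x y : K) : (x + y) ^ q = x ^ q + y ^ q := by
    obtain ⟨p, hp⟩ := CharP.exists F
    obtain ⟨n, hprime, hn⟩ := FiniteField.card F p
    have : Fact p.Prime := ⟨hprime⟩
    have : CharP K p := charP_of_injective_algebraMap φ.injective p
    rw [hq, hn, add_pow_char_pow]
  let Y := (nthRoots (q - 1) (1 : K)).toFinset
  let Z := (nthRoots (q + 1) (φ a)).toFinset
  have hY {y : K} : y ∈ Y ↔ y ^ (q - 1) = 1 := by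
    simp only [Y, Multiset.mem_toFinset]
    exact mem_nthRoots (by omega)
  have hZ {y : K} : y ∈ Z ↔ y ^ (q + 1) = φ a := by
    simp only [Z, Multiset.mem_toFinset]
    exact mem_nthRoots (by omega)
  have hY0 {y : K} (hy : y ∈ Y) : y ≠ 0 := by
    rintro rfl
    rw [hY, zero_pow (by omega)] at hy
    exact zero_ne_one hy
  have hZ0 {y : K} (hy : y ∈ Z) : y ≠ 0 := by
    rintro rfl
    rw [hZ, zero_pow (by omega)] at hy
    exact hα hy.symm
  have hYcard : Y.card = q - 1 :=
    card_toFinset_nthRoots (by simp [Nat.cast_sub hq1.le, hqK]) one_ne_zero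
  have hZcard : Z.card = q + 1 := card_toFinset_nthRoots (by simp [hqK]) hα
  have hYle := card_toFinset_nthRoots_le_gcd_mul m (by omega : 0 < q - 1) (one_ne_zero (α := K))
  have hZle := card_toFinset_nthRoots_le_gcd_mul m (by omega : 0 < q + 1) hα
  change Y.card ≤ _ * (Y.image (· ^ m)).card at hYle
  change Z.card ≤ _ * (Z.image (· ^ m)).card at hZle
  rw [hYcard] at hYle
  rw [hZcard] at hZle
  set V := Finset.univ.image fun x ↦ (dickson 1 a m).eval x with hV
  have hvalue {y : K} (hy0 : y ≠ 0) (hfix : (y + φ a / y) ^ q = y + φ a / y) :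
      y ^ m + φ a ^ m / y ^ m ∈ V.image φ := by
    obtain ⟨x, hx⟩ := FiniteField.exists_algebraMap_eq_of_pow_card_eq hfix
    refine Finset.mem_image.mpr ⟨(dickson 1 a m).eval x,
      Finset.mem_image_of_mem _ (Finset.mem_univ _), ?_⟩
    change φ x = _ at hx
    rw [← Polynomial.eval_map_apply, map_dickson, hx,
      eval_dickson_one_add (mul_div_cancel₀ _ hy0), div_pow]
  have hle : (Y.image (· ^ m)).card + (Z.image (· ^ m)).card ≤ 2 * (V.image φ).card := by
    refine card_add_card_le_two_mul_of_maps_to_add_div (c := φ a ^ m) ?_ ?_ ?_ ?_ ?_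
    · simp only [Finset.forall_mem_image]
      exact fun y hy ↦ pow_ne_zero _ (hY0 hy)
    · simp only [Finset.forall_mem_image]
      exact fun y hy ↦ pow_ne_zero _ (hZ0 hy)
    · intro z hz hz'
      obtain ⟨y, hy, rfl⟩ := Finset.mem_image.mp hz
      obtain ⟨w, hw, hwy⟩ := Finset.mem_image.mp hz'
      rw [hY] at hy
      rw [hZ] at hw
      have h1 : (y ^ m) ^ (q - 1) = 1 := by rw [pow_right_comm, hy, one_pow]
      have h2 : (y ^ m) ^ (q + 1) = φ a ^ m := by
        rw [← hw, pow_right_comm w]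
        exact congrArg (· ^ (q + 1)) hwy.symm
      rw [show q + 1 = q - 1 + 2 by omega, pow_add, h1, one_mul] at h2
      exact h2
    · simp only [Finset.forall_mem_image]
      intro y hy
      refine hvalue (hY0 hy) ?_
      have hyq : y ^ q = y := by
        rw [show q = q - 1 + 1 by omega, pow_succ, hY.mp hy, one_mul]
      rw [hadd, div_pow, hyq, hαq]
    · simp only [Finset.forall_mem_image]
      intro y hy
      have hy0 := hZ0 hy
      refine hvalue hy0 ?_
      have hyq : y ^ q = φ a / y := by
        rw [eq_div_iff hy0, ← pow_succ, hZ.mp hy]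
      rw [hadd, div_pow, hαq, hyq, div_div_cancel₀ hα, add_comm]
  rw [Finset.card_image_of_injective _ φ.injective] at hle
  have hgY : (0 : ℚ) < Nat.gcd m (q - 1) := by exact_mod_cast Nat.gcd_pos_of_pos_left _ hm
  have hgZ : (0 : ℚ) < Nat.gcd m (q + 1) := by exact_mod_cast Nat.gcd_pos_of_pos_left _ hm
  have hYle' : ((q : ℚ) - 1) / Nat.gcd m (q - 1) ≤ (Y.image (· ^ m)).card := by
    rw [div_le_iff₀' hgY, ← Nat.cast_one, ← Nat.cast_sub hq1.le]
    exact_mod_cast hYle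
  have hZle' : ((q : ℚ) + 1) / Nat.gcd m (q + 1) ≤ (Z.image (· ^ m)).card := by
    rw [div_le_iff₀' hgZ]
    exact_mod_cast hZle
  have hle' : ((Y.image (· ^ m)).card : ℚ) + (Z.image (· ^ m)).card ≤ 2 * V.card := by
    exact_mod_cast hle
  linarith


/-- Nontrivial solutions of homogeneous Dickson equations with odd degrees. -/
theorem stmt_13 (F : Type*) [Field F] [Fintype F] (q n : ℕ) (hq : Fintype.card F = q)
    (m : Fin n → ℕ) (hm : ∀ j, 0 < m j) (hmodd : ∀ j, Odd (m j))
    (b : Fin n → F) (hb : ∀ j, b j ≠ 0) (a : Fin n → F) (ha : ∀ j, a j ≠ 0)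
    (hineq : (1 : ℚ) + n / (q - 1)
      < (1 / 2) * ∑ j, (1 : ℚ) / Nat.gcd (m j) (q - 1)
        + (1 / 2 + 1 / (q - 1)) * ∑ j, (1 : ℚ) / Nat.gcd (m j) (q + 1)) :
    ∃ x : Fin n → F, x ≠ 0 ∧
      ∑ j, b j * (Polynomial.dickson 1 (a j) (m j)).eval (x j) = 0 := by
  classical
  subst hq
  set q := Fintype.card F
  have hq1 : 1 < q := Fintype.one_lt_card
  let V (j : Fin n) : Finset F :=
    Finset.univ.image fun x ↦ (Polynomial.dickson 1 (a j) (m j)).eval x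
  have h0 (j : Fin n) : 0 ∈ V j := Finset.mem_image.mpr
    ⟨0, Finset.mem_univ _, Polynomial.eval_zero_dickson_of_odd 1 (a j) (hmodd j)⟩
  have hcard : q - 1 < ∑ j, ((V j).card - 1) := by
    have hbound : ∑ j, (((q : ℚ) - 1) / Nat.gcd (m j) (q - 1) +
        ((q : ℚ) + 1) / Nat.gcd (m j) (q + 1)) ≤ ∑ j, 2 * ((V j).card : ℚ) :=
      Finset.sum_le_sum fun j _ ↦
        FiniteField.le_two_mul_card_image_eval_dickson (ha j) (hm j)
    simp only [Finset.sum_add_distrib, ← Finset.mul_sum, div_eq_mul_one_div ((q : ℚ) - 1),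
      div_eq_mul_one_div ((q : ℚ) + 1)] at hbound
    have hqpos : (0 : ℚ) < (q : ℚ) - 1 := sub_pos.mpr (by exact_mod_cast hq1)
    have hscaled := mul_lt_mul_of_pos_left hineq hqpos
    have hleft : ((q : ℚ) - 1) * (1 + n / (q - 1)) = q - 1 + n := by
      field_simp
    have hright (s t : ℚ) : ((q : ℚ) - 1) * ((1 / 2) * s + (1 / 2 + 1 / (q - 1)) * t) =
        (((q : ℚ) - 1) * s + (q + 1) * t) / 2 := by
      field_simp
      ring
    rw [hleft, hright] at hscaled
    have hcast : ((∑ j, ((V j).card - 1) : ℕ) : ℚ) = ∑ j, ((V j).card : ℚ) - n := by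
      rw [Nat.cast_sum, Finset.sum_congr rfl fun j _ ↦
        Nat.cast_sub (Finset.card_pos.mpr ⟨0, h0 j⟩)]
      simp
    have hgoal : ((q - 1 : ℕ) : ℚ) < ((∑ j, ((V j).card - 1) : ℕ) : ℚ) := by
      rw [hcast, Nat.cast_sub hq1.le, Nat.cast_one]
      linarith
    exact_mod_cast hgoal
  obtain ⟨v, hv0, hvV, hv⟩ := FiniteField.exists_ne_zero_sum_mul_eq_zero b V h0 hcard
  choose x _ hx using fun j ↦ Finset.mem_image.mp (hvV j)
  refine ⟨x, ?_, by simpa only [hx] using hv⟩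
  rintro rfl
  refine hv0 (funext fun j ↦ ?_)
  rw [← hx j]
  exact Polynomial.eval_zero_dickson_of_odd 1 (a j) (hmodd j)
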